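/- arXiv:0904.4105 — 3 statements merged into one kernel-verified Lean document; each statement's English description precedes it below -/
import Mathlib

section
/- Let β ∈ {1, 2} and let F : ℝ³ → ℝ be a nonnegative measurable function, not almost everywhere zero, such that the function y ↦ (1 + |y|^{β+1})F(y) is integrable and essentially bounded on ℝ³. Define Ψ_β[F](x) = ∫_{ℝ³} F(y)/|x−y|^β dy. Then there exist positive constants C and C' (depending on β and F) such that |Ψ_β[F](x) − C/|x|^β| ≤ C'/|x|^{β+1} for all x ≠ 0. -/
open MeasureTheory Filter Real Topology

noncomputable section

abbrev E3 := EuclideanSpace ℝ (Fin 3)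

/-- The pointwise kernel estimate behind the expansion, with `r = ‖x‖`, `s = ‖x - y‖`, `t = ‖y‖`. -/
theorem abs_inv_rpow_sub_inv_rpow_le {β r s t : ℝ} (hβ : β = 1 ∨ β = 2) (hr : 0 < r) (hs : 0 < s)
    (hst : |r - s| ≤ t) :
    |(s ^ β)⁻¹ - (r ^ β)⁻¹| ≤
      6 / r ^ (β + 1) * ((1 + t ^ (β + 1)) * (1 + (Set.Iio 1).indicator (fun u => u ^ (-β)) s)) := by
  have ht : 0 ≤ t := (abs_nonneg _).trans hst
  have hrs : r ≤ s + t := by linarith [le_abs_self (r - s)]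
  have key : r * |r ^ β - s ^ β| ≤
      6 * (1 + t ^ (β + 1)) * (s ^ β + (if s < 1 then 1 else 0)) := by
    rcases hβ with rfl | rfl
    · norm_num
      have h1 : r * |r - s| ≤ (s + t) * t := by gcongr
      refine h1.trans ?_
      split_ifs with h
      · nlinarith [sq_nonneg (t - 1), mul_nonneg hs.le (sq_nonneg (t - 1)),
          mul_nonneg hs.le (sq_nonneg t)]
      · push Not at h
        nlinarith [sq_nonneg (t - 1), mul_nonneg hs.le (sq_nonneg (t - 1)),
          mul_nonneg (sub_nonneg.2 h) (sq_nonneg t)]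
    · have e3 : (2 : ℝ) + 1 = (3 : ℕ) := by norm_num
      rw [e3, rpow_natCast, rpow_two, rpow_two]
      have h1 : r * |r ^ 2 - s ^ 2| ≤ (s + t) * (t * (2 * s + t)) := by
        rw [sq_sub_sq, abs_mul, abs_of_pos (by positivity : 0 < r + s), mul_comm (r + s)]
        have h2 : r + s ≤ 2 * s + t := by linarith
        gcongr
      refine h1.trans ?_
      have a1 : t ≤ 1 + t ^ 3 := by
        nlinarith [sq_nonneg (t - 1), mul_nonneg ht (sq_nonneg (t - 1))]
      have a2 : t ^ 2 ≤ 1 + t ^ 3 := by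
        nlinarith [sq_nonneg (t - 1), mul_nonneg ht (sq_nonneg (t - 1))]
      have a3 : t ^ 3 ≤ 1 + t ^ 3 := by linarith
      have e : (s + t) * (t * (2 * s + t)) = 2 * s ^ 2 * t + 3 * s * t ^ 2 + t ^ 3 := by ring
      rw [e]
      set G := 1 + t ^ 3
      have hG : 0 ≤ G := by positivity
      have b1 : 2 * s ^ 2 * t ≤ 2 * s ^ 2 * G := by gcongr
      have b2 : 3 * s * t ^ 2 ≤ 3 * s * G := by gcongr
      split_ifs with h
      · nlinarith [mul_nonneg (sub_nonneg.2 h.le) hG, mul_nonneg (sq_nonneg s) hG]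
      · push Not at h
        nlinarith [mul_nonneg (sub_nonneg.2 h) hG,
          mul_nonneg (mul_nonneg hs.le (sub_nonneg.2 h)) hG]
  have hsβ : 0 < s ^ β := by positivity
  have hrβ : 0 < r ^ β := by positivity
  have e1 : (s ^ β)⁻¹ - (r ^ β)⁻¹ = (r ^ β - s ^ β) / (s ^ β * r ^ β) := by field_simp
  have e2 : 1 + (Set.Iio 1).indicator (fun u => u ^ (-β)) s
      = (s ^ β + (if s < 1 then 1 else 0)) / s ^ β := by
    rw [Set.indicator_apply]
    simp only [Set.mem_Iio, rpow_neg hs.le]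
    split_ifs <;> field_simp
    simp
  rw [e1, e2, abs_div, abs_of_pos (by positivity : 0 < s ^ β * r ^ β), rpow_add_one hr.ne']
  calc |r ^ β - s ^ β| / (s ^ β * r ^ β)
      = (r * |r ^ β - s ^ β|) / (r ^ β * r * s ^ β) := by field_simp
    _ ≤ (6 * (1 + t ^ (β + 1)) * (s ^ β + (if s < 1 then 1 else 0))) / (r ^ β * r * s ^ β) := by
        gcongr
    _ = _ := by field_simp

/-- The truncated Riesz kernel is integrable below the critical exponent. -/
theorem integrable_indicator_rpow_neg_norm {β : ℝ} (hβ : β < 3) :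
    Integrable (fun y : E3 => (Set.Iio 1).indicator (fun u : ℝ => u ^ (-β)) ‖y‖) := by
  rw [integrable_fun_norm_addHaar volume (f := (Set.Iio 1).indicator (fun u : ℝ => u ^ (-β)))]
  have h : IntegrableOn (fun u : ℝ => u ^ (2 - β)) (Set.Ioo 0 1) :=
    (intervalIntegral.integrableOn_Ioo_rpow_iff one_pos).2 (by linarith)
  have h' := h.integrable_indicator measurableSet_Ioo
  refine h'.integrableOn.congr_fun (fun u hu => ?_) measurableSet_Ioi
  have hu : 0 < u := hu
  simp only [Set.indicator_apply, Set.mem_Ioo, Set.mem_Iio, hu, true_and, finrank_euclideanSpace,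
    Fintype.card_fin, smul_eq_mul]
  split_ifs
  · rw [sub_eq_add_neg, rpow_add hu, rpow_two]
  · simp

/-- asymptotic expansion of the Riesz-type potential `Ψ_β[F]`. -/
theorem riesz_potential_expansion (β : ℝ) (hβ : β = 1 ∨ β = 2)
    (F : E3 → ℝ) (hFmeas : Measurable F) (hFnonneg : ∀ y, 0 ≤ F y)
    (hFne : ¬ (F =ᵐ[(volume : Measure E3)] 0))
    (hFint : Integrable (fun y : E3 => (1 + ‖y‖ ^ (β + 1)) * F y))
    (hFbdd : ∃ M : ℝ, ∀ᵐ y : E3 ∂volume, (1 + ‖y‖ ^ (β + 1)) * F y ≤ M) :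
    ∃ C > 0, ∃ C' > 0, ∀ x : E3, x ≠ 0 →
      |(∫ y : E3, F y / ‖x - y‖ ^ β) - C / ‖x‖ ^ β| ≤ C' / ‖x‖ ^ (β + 1) := by
  obtain ⟨M, hM⟩ := hFbdd
  have hFi : Integrable F := by
    refine hFint.mono' hFmeas.aestronglyMeasurable (ae_of_all _ fun y => ?_)
    rw [norm_of_nonneg (hFnonneg y)]
    have : 0 ≤ ‖y‖ ^ (β + 1) := by positivity
    nlinarith [mul_nonneg this (hFnonneg y)]
  have hC : 0 < ∫ y, F y := by
    refine (integral_nonneg hFnonneg).lt_of_ne' fun h => hFne ?_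
    exact (integral_eq_zero_iff_of_nonneg hFnonneg hFi).1 h
  set φ : E3 → ℝ := fun y => (Set.Iio 1).indicator (fun u : ℝ => u ^ (-β)) ‖y‖ with hφdef
  set G : E3 → ℝ := fun y => (1 + ‖y‖ ^ (β + 1)) * F y with hG
  have hφ : Integrable φ :=
    integrable_indicator_rpow_neg_norm (by rcases hβ with rfl | rfl <;> norm_num)
  have hφ0 : ∀ y, 0 ≤ φ y := fun y => Set.indicator_apply_nonneg fun _ => by positivity
  have hG0 : ∀ y, 0 ≤ G y := fun y => mul_nonneg (by positivity) (hFnonneg y)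
  have hM0 : 0 ≤ M := by
    obtain ⟨y, hy⟩ := hM.exists
    exact (hG0 y).trans hy
  have hI : 0 ≤ (∫ y, G y) + M * ∫ y, φ y :=
    add_nonneg (integral_nonneg hG0) (mul_nonneg hM0 (integral_nonneg hφ0))
  refine ⟨_, hC, 6 * ((∫ y, G y) + M * ∫ y, φ y) + 1, by positivity, fun x hx => ?_⟩
  have hr : 0 < ‖x‖ := norm_pos_iff.2 hx
  have hφx : Integrable fun y => φ (x - y) := hφ.comp_sub_left x
  have hbi : Integrable fun y => 6 / ‖x‖ ^ (β + 1) * (G y + M * φ (x - y)) :=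
    (hFint.add (hφx.const_mul M)).const_mul _
  have hb : ∀ᵐ y : E3, ‖F y / ‖x - y‖ ^ β - F y / ‖x‖ ^ β‖ ≤
      6 / ‖x‖ ^ (β + 1) * (G y + M * φ (x - y)) := by
    filter_upwards [hM, Measure.ae_ne volume x] with y hy hyx
    have hs : 0 < ‖x - y‖ := norm_pos_iff.2 (sub_ne_zero.2 hyx.symm)
    have hst : |‖x‖ - ‖x - y‖| ≤ ‖y‖ := by
      simpa using abs_norm_sub_norm_le x (x - y)
    have h := mul_le_mul_of_nonneg_left (abs_inv_rpow_sub_inv_rpow_le hβ hr hs hst) (hFnonneg y)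
    calc ‖F y / ‖x - y‖ ^ β - F y / ‖x‖ ^ β‖
        = F y * |(‖x - y‖ ^ β)⁻¹ - (‖x‖ ^ β)⁻¹| := by
          rw [div_eq_mul_inv, div_eq_mul_inv, ← mul_sub, norm_mul, norm_of_nonneg (hFnonneg y),
            norm_eq_abs]
      _ ≤ _ := h
      _ = 6 / ‖x‖ ^ (β + 1) * (G y + G y * φ (x - y)) := by simp only [hG, hφdef]; ring
      _ ≤ _ := by
          have := hφ0 (x - y)
          gcongr
  have hD : Integrable fun y => F y / ‖x - y‖ ^ β - F y / ‖x‖ ^ β :=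
    hbi.mono' (by fun_prop) hb
  have hFs : Integrable fun y => F y / ‖x - y‖ ^ β :=
    (hD.add (hFi.div_const (‖x‖ ^ β))).congr (ae_of_all _ fun y => by simp)
  rw [← integral_div, ← integral_sub hFs (hFi.div_const _), ← norm_eq_abs]
  refine (norm_integral_le_of_norm_le hbi hb).trans ?_
  rw [integral_const_mul, integral_add hFint (hφx.const_mul M), integral_const_mul,
    integral_sub_left_eq_self φ volume x, div_mul_eq_mul_div]
  gcongr
  linarith
end
end

section
/- Let e₁ = (1,0,0) ∈ ℝ³. Then the integral η' = ∫_{ℝ³} U(x)^p e^{−x₁} dx is finite and positive, and lim_{t → +∞} t e^{t} ∫_{ℝ³} U(x)^p U(x − t e₁) dx = c · η', where c = lim_{r→∞} Ū(r) r e^{r}. Equivalently, for P = t e₁, ∫_{ℝ³} U(x)^p U(x − P) dx = (c η' + o(1)) e^{−|P|} / |P| as |P| → ∞. -/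
open MeasureTheory Filter Real Topology

noncomputable section

lemma integrable_exp_neg_mul_norm {a : ℝ} (ha : 0 < a) :
    Integrable (fun x : E3 => Real.exp (-(a * ‖x‖))) := by
  have hr : ((Module.finrank ℝ E3 : ℕ) : ℝ) < 4 := by simp; norm_num
  refine ((integrable_one_add_norm (μ := (volume : Measure E3)) hr).const_mul
    ((4 / a) ^ 4 * Real.exp a)).mono' (by fun_prop) (ae_of_all _ fun x => ?_)
  rw [Real.norm_of_nonneg (Real.exp_pos _).le]
  have h0 : 0 < 1 + ‖x‖ := by positivity
  have h1 : a / 4 * (1 + ‖x‖) ≤ Real.exp (a / 4 * (1 + ‖x‖)) := by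
    linarith [Real.add_one_le_exp (a / 4 * (1 + ‖x‖))]
  have h2 := pow_le_pow_left₀ (by positivity) h1 4
  rw [← Real.exp_nat_mul, mul_pow] at h2
  have h3 : Real.exp (((4 : ℕ) : ℝ) * (a / 4 * (1 + ‖x‖))) =
      Real.exp a * Real.exp (a * ‖x‖) := by
    rw [← Real.exp_add]; congr 1; push_cast; ring
  rw [h3] at h2
  have h4 : (1 + ‖x‖) ^ (-4 : ℝ) = ((1 + ‖x‖) ^ 4)⁻¹ := by
    rw [Real.rpow_neg h0.le]; norm_cast
  rw [h4, Real.exp_neg, ← div_eq_mul_inv, inv_eq_one_div,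
    div_le_div_iff₀ (Real.exp_pos _) (by positivity)]
  calc 1 * (1 + ‖x‖) ^ 4 = (4 / a) ^ 4 * ((a / 4) ^ 4 * (1 + ‖x‖) ^ 4) := by
        field_simp
    _ ≤ (4 / a) ^ 4 * (Real.exp a * Real.exp (a * ‖x‖)) := by gcongr
    _ = _ := by ring

/-- A continuous radial function whose profile is asymptotic to a multiple of `e^{-r} / r`
is globally bounded by a multiple of `e^{-r} / (1 + r)`. -/
lemma exists_mul_exp_norm_le {U : E3 → ℝ} (hUc : Continuous U) {Ub : ℝ → ℝ}
    (hUrad : ∀ x, U x = Ub ‖x‖) {c : ℝ}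
    (hUlim : Tendsto (fun r : ℝ => Ub r * r * Real.exp r) atTop (𝓝 c)) :
    ∃ A : ℝ, 0 < A ∧ ∀ x, U x * ((1 + ‖x‖) * Real.exp ‖x‖) ≤ A := by
  have hev : ∀ᶠ r : ℝ in atTop, |Ub r * r * Real.exp r| < |c| + 1 :=
    hUlim.abs.eventually (gt_mem_nhds (by linarith))
  obtain ⟨R, hR⟩ := eventually_atTop.1 (hev.and (eventually_ge_atTop (1 : ℝ)))
  have hcont : Continuous fun x : E3 => U x * ((1 + ‖x‖) * Real.exp ‖x‖) := by fun_prop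
  obtain ⟨B, hB⟩ := (isCompact_closedBall (0 : E3) R).bddAbove_image hcont.continuousOn
  refine ⟨max B (2 * (|c| + 1)), lt_max_of_lt_right (by positivity), fun x => ?_⟩
  rcases le_total ‖x‖ R with h | h
  · exact le_max_of_le_left (hB ⟨x, by simpa using h, rfl⟩)
  · refine le_max_of_le_right ?_
    obtain ⟨h1, h2⟩ := hR _ h
    rw [← hUrad] at h1
    have h3 : U x ≤ |U x| := le_abs_self _
    have h4 : |U x * ‖x‖ * Real.exp ‖x‖| = |U x| * ‖x‖ * Real.exp ‖x‖ := by
      rw [abs_mul, abs_mul, abs_norm, abs_of_pos (Real.exp_pos _)]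
    calc U x * ((1 + ‖x‖) * Real.exp ‖x‖) ≤ |U x| * ((‖x‖ + ‖x‖) * Real.exp ‖x‖) := by
          gcongr
      _ = 2 * |U x * ‖x‖ * Real.exp ‖x‖| := by rw [h4]; ring
      _ ≤ _ := by linarith

lemma integrable_rpow_mul_exp_norm {p : ℝ} (hp : 1 < p) {U : E3 → ℝ} (hUc : Continuous U)
    (hUpos : ∀ x, 0 < U x) {A : ℝ} (hA : ∀ x, U x * ((1 + ‖x‖) * Real.exp ‖x‖) ≤ A) :
    Integrable (fun x : E3 => U x ^ p * ((1 + ‖x‖) * Real.exp ‖x‖)) := by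
  have hcont : Continuous fun x : E3 => U x ^ p * ((1 + ‖x‖) * Real.exp ‖x‖) :=
    (hUc.rpow_const fun x => Or.inl (hUpos x).ne').mul (by fun_prop)
  refine ((integrable_exp_neg_mul_norm (sub_pos.2 hp)).const_mul (A ^ p)).mono'
    hcont.aestronglyMeasurable (ae_of_all _ fun x => ?_)
  have hU := hUpos x
  have hw : 0 < (1 + ‖x‖) * Real.exp ‖x‖ := by positivity
  rw [Real.norm_of_nonneg (by positivity)]
  set w := (1 + ‖x‖) * Real.exp ‖x‖ with hwdef
  have h1 : (U x * w) ^ p ≤ A ^ p :=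
    Real.rpow_le_rpow (by positivity) (hA x) (by linarith)
  have h2 : w ^ (1 - p) ≤ Real.exp (-((p - 1) * ‖x‖)) := by
    calc w ^ (1 - p) ≤ (Real.exp ‖x‖) ^ (1 - p) := by
          refine Real.rpow_le_rpow_of_nonpos (Real.exp_pos _) ?_ (by linarith)
          rw [hwdef]
          nlinarith [Real.exp_pos ‖x‖, norm_nonneg x]
      _ = _ := by rw [← Real.exp_mul]; congr 1; ring
  calc U x ^ p * w = (U x * w) ^ p * w ^ (1 - p) := by
        rw [Real.mul_rpow hU.le hw.le, mul_assoc, ← Real.rpow_add hw]; simp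
    _ ≤ _ := by
        gcongr
        exact (by positivity : 0 ≤ (U x * w) ^ p).trans h1

lemma neg_coord_zero_le_norm (x : E3) : -(x 0) ≤ ‖x‖ :=
  (neg_le_abs _).trans (by simpa using PiLp.norm_apply_le x 0)

lemma norm_smul_single_zero {t : ℝ} (ht : 0 ≤ t) :
    ‖t • EuclideanSpace.single (0 : Fin 3) (1 : ℝ)‖ = t := by
  simp [norm_smul, abs_of_nonneg ht]

lemma norm_sub_smul_single_sq (x : E3) (t : ℝ) :
    ‖x - t • EuclideanSpace.single (0 : Fin 3) (1 : ℝ)‖ ^ 2 =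
      ‖x‖ ^ 2 - 2 * t * x 0 + t ^ 2 := by
  rw [norm_sub_sq_real, inner_smul_right, EuclideanSpace.inner_single_right]
  simp [norm_smul]
  ring

lemma tendsto_norm_sub_smul_single_atTop (x : E3) :
    Tendsto (fun t : ℝ => ‖x - t • EuclideanSpace.single (0 : Fin 3) (1 : ℝ)‖) atTop atTop := by
  refine tendsto_atTop_mono' _ ?_ (tendsto_atTop_add_const_right _ (-‖x‖) tendsto_id)
  filter_upwards [eventually_ge_atTop (0 : ℝ)] with t ht
  have := norm_sub_norm_le (t • EuclideanSpace.single (0 : Fin 3) (1 : ℝ)) x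
  rw [norm_smul_single_zero ht, norm_sub_rev] at this
  simpa [sub_eq_add_neg] using this

lemma tendsto_div_norm_sub_smul_single (x : E3) :
    Tendsto (fun t : ℝ => t / ‖x - t • EuclideanSpace.single (0 : Fin 3) (1 : ℝ)‖)
      atTop (𝓝 1) := by
  have hs := tendsto_norm_sub_smul_single_atTop x
  have h0 : Tendsto (fun t : ℝ => (t - ‖x - t • EuclideanSpace.single (0 : Fin 3) (1 : ℝ)‖) /
      ‖x - t • EuclideanSpace.single (0 : Fin 3) (1 : ℝ)‖) atTop (𝓝 0) := by
    refine squeeze_zero_norm' ?_ (hs.const_div_atTop ‖x‖)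
    filter_upwards [eventually_ge_atTop (0 : ℝ)] with t ht
    rw [norm_div, norm_norm]
    gcongr
    have h := abs_norm_sub_norm_le (t • EuclideanSpace.single (0 : Fin 3) (1 : ℝ))
      (t • EuclideanSpace.single (0 : Fin 3) (1 : ℝ) - x)
    rw [norm_smul_single_zero ht, norm_sub_rev _ x] at h
    simpa using h
  have h1 := h0.add_const 1
  rw [zero_add] at h1
  refine h1.congr' ?_
  filter_upwards [hs.eventually_gt_atTop 0] with t ht
  field_simp
  ring

lemma tendsto_sub_norm_sub_smul_single (x : E3) :
    Tendsto (fun t : ℝ => t - ‖x - t • EuclideanSpace.single (0 : Fin 3) (1 : ℝ)‖)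
      atTop (𝓝 (x 0)) := by
  have hs := tendsto_norm_sub_smul_single_atTop x
  have hd := tendsto_div_norm_sub_smul_single x
  have h := ((hd.const_mul (2 * x 0)).sub (hs.const_div_atTop (‖x‖ ^ 2))).div
    (hd.add_const 1) (by norm_num)
  have e : (2 * x 0 * 1 - 0) / (1 + 1) = x 0 := by ring
  rw [e] at h
  refine h.congr' ?_
  filter_upwards [hs.eventually_gt_atTop 0, eventually_ge_atTop (0 : ℝ)] with t ht ht0
  have hsq := norm_sub_smul_single_sq x t
  simp only [Pi.div_apply]
  set s := ‖x - t • EuclideanSpace.single (0 : Fin 3) (1 : ℝ)‖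
  have : t / s + 1 ≠ 0 := by positivity
  have : t + s ≠ 0 := by positivity
  field_simp
  linarith

/-- Along the first coordinate direction, the rescaled translates of `U` converge pointwise. -/
lemma tendsto_rescaled_translate {U : E3 → ℝ} {Ub : ℝ → ℝ}
    (hUrad : ∀ x, U x = Ub ‖x‖) {c : ℝ}
    (hUlim : Tendsto (fun r : ℝ => Ub r * r * Real.exp r) atTop (𝓝 c)) (x : E3) :
    Tendsto (fun t : ℝ => t * Real.exp t *
        U (x - t • EuclideanSpace.single (0 : Fin 3) (1 : ℝ)))
      atTop (𝓝 (c * Real.exp (x 0))) := by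
  have hs := tendsto_norm_sub_smul_single_atTop x
  have h := ((hUlim.comp hs).mul (tendsto_div_norm_sub_smul_single x)).mul
    ((Real.continuous_exp.tendsto _).comp (tendsto_sub_norm_sub_smul_single x))
  rw [mul_one] at h
  refine h.congr' ?_
  filter_upwards [hs.eventually_gt_atTop 0] with t ht
  simp only [Function.comp_apply, Real.exp_sub]
  rw [hUrad]
  field_simp

/-- The rescaled translates of `U` are dominated uniformly in `t`. -/
lemma rescaled_translate_le {U : E3 → ℝ} {A : ℝ}
    (hA : ∀ x, U x * ((1 + ‖x‖) * Real.exp ‖x‖) ≤ A) (hA0 : 0 < A)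
    {t : ℝ} (ht : 0 ≤ t) (x : E3) :
    t * Real.exp t * U (x - t • EuclideanSpace.single (0 : Fin 3) (1 : ℝ)) ≤
      A * ((1 + ‖x‖) * Real.exp ‖x‖) := by
  have h := norm_sub_norm_le (t • EuclideanSpace.single (0 : Fin 3) (1 : ℝ)) x
  rw [norm_smul_single_zero ht, norm_sub_rev] at h
  have hAy := hA (x - t • EuclideanSpace.single (0 : Fin 3) (1 : ℝ))
  set y := x - t • EuclideanSpace.single (0 : Fin 3) (1 : ℝ)
  have hx := norm_nonneg x
  have hy := norm_nonneg y
  have hU : U y ≤ A / ((1 + ‖y‖) * Real.exp ‖y‖) := by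
    rwa [le_div_iff₀ (by positivity)]
  have h1 : t ≤ (1 + ‖x‖) * (1 + ‖y‖) := by nlinarith
  have h2 : Real.exp t ≤ Real.exp ‖x‖ * Real.exp ‖y‖ := by
    rw [← Real.exp_add]; exact Real.exp_le_exp.2 (by linarith)
  calc t * Real.exp t * U y
      ≤ t * Real.exp t * (A / ((1 + ‖y‖) * Real.exp ‖y‖)) := by gcongr
    _ ≤ ((1 + ‖x‖) * (1 + ‖y‖)) * (Real.exp ‖x‖ * Real.exp ‖y‖) *
          (A / ((1 + ‖y‖) * Real.exp ‖y‖)) := by gcongr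
    _ = A * ((1 + ‖x‖) * Real.exp ‖x‖) := by field_simp

/-- the interaction integral `∫ U(x)^p U(x - t e₁) dx` behaves like
`(c η' + o(1)) e^{-t}/t` as `t → ∞`, where `η' = ∫ U(x)^p e^{-x₁} dx`. -/
theorem interaction_integral_asymptotics (p : ℝ) (hp : 1 < p)
    (U : E3 → ℝ) (hUc : Continuous U) (hUpos : ∀ x, 0 < U x)
    (Ub : ℝ → ℝ) (hUrad : ∀ x, U x = Ub ‖x‖)
    (c : ℝ) (hc : 0 < c)
    (hUlim : Tendsto (fun r : ℝ => Ub r * r * Real.exp r) atTop (𝓝 c)) :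
    Integrable (fun x : E3 => U x ^ p * Real.exp (-(x 0))) ∧
    0 < (∫ x : E3, U x ^ p * Real.exp (-(x 0))) ∧
    Tendsto
      (fun t : ℝ => t * Real.exp t *
        ∫ x : E3, U x ^ p * U (x - t • EuclideanSpace.single (0 : Fin 3) (1 : ℝ)))
      atTop (𝓝 (c * ∫ x : E3, U x ^ p * Real.exp (-(x 0)))) := by
  obtain ⟨A, hA0, hA⟩ := exists_mul_exp_norm_le hUc hUrad hUlim
  have hg := integrable_rpow_mul_exp_norm hp hUc hUpos hA
  have hUp : ∀ x, 0 < U x ^ p := fun x => Real.rpow_pos_of_pos (hUpos x) p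
  have hUpc : Continuous fun x => U x ^ p := hUc.rpow_const fun x => Or.inl (hUpos x).ne'
  have hcont : Continuous fun x : E3 => U x ^ p * Real.exp (-(x 0)) := hUpc.mul (by fun_prop)
  have hint : Integrable (fun x : E3 => U x ^ p * Real.exp (-(x 0))) := by
    refine hg.mono' hcont.aestronglyMeasurable (ae_of_all _ fun x => ?_)
    have := hUp x
    rw [Real.norm_of_nonneg (by positivity)]
    refine mul_le_mul_of_nonneg_left ?_ this.le
    have h1 := Real.exp_le_exp.2 (neg_coord_zero_le_norm x)
    nlinarith [Real.exp_pos ‖x‖, norm_nonneg x]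
  refine ⟨hint, ?_, ?_⟩
  · rw [integral_pos_iff_support_of_nonneg (fun x => (mul_pos (hUp x) (Real.exp_pos _)).le) hint]
    have : Function.support (fun x : E3 => U x ^ p * Real.exp (-(x 0))) = Set.univ :=
      Set.eq_univ_of_forall fun x => (mul_pos (hUp x) (Real.exp_pos _)).ne'
    rw [this]
    exact isOpen_univ.measure_pos _ Set.univ_nonempty
  · have hsymm : (∫ x : E3, U x ^ p * Real.exp (-(x 0))) =
        ∫ x : E3, U x ^ p * Real.exp (x 0) := by
      rw [← integral_neg_eq_self (fun x : E3 => U x ^ p * Real.exp (x 0))]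
      simp [hUrad]
    rw [hsymm, ← integral_const_mul]
    simp_rw [← integral_const_mul]
    refine tendsto_integral_filter_of_dominated_convergence
      (fun x => A * (U x ^ p * ((1 + ‖x‖) * Real.exp ‖x‖))) ?_ ?_ (hg.const_mul A) ?_
    · exact Eventually.of_forall fun t => (continuous_const.mul
        (hUpc.mul (hUc.comp (by fun_prop)))).aestronglyMeasurable
    · filter_upwards [eventually_ge_atTop (0 : ℝ)] with t ht
      refine ae_of_all _ fun x => ?_
      have h1 := hUp x
      have h2 := hUpos (x - t • EuclideanSpace.single (0 : Fin 3) (1 : ℝ))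
      rw [Real.norm_of_nonneg (by positivity)]
      calc _ = U x ^ p * (t * Real.exp t *
            U (x - t • EuclideanSpace.single (0 : Fin 3) (1 : ℝ))) := by ring
        _ ≤ U x ^ p * (A * ((1 + ‖x‖) * Real.exp ‖x‖)) := by
            gcongr ?_ * ?_
            exact rescaled_translate_le hA hA0 ht x
        _ = _ := by ring
    · refine ae_of_all _ fun x => ?_
      have h := (tendsto_rescaled_translate hUrad hUlim x).const_mul (U x ^ p)
      convert h using 2 <;> ring
end
end

section
/- There exist constants C > 0 and σ > 0, depending only on K, p, and U, such that for all points P_1, …, P_K ∈ ℝ³ with |P_i − P_j| ≥ 1 for all i ≠ j, one has ∫_{ℝ³} | (Σ_{i=1}^K U(x − P_i))^{p+1} − Σ_{i=1}^K U(x − P_i)^{p+1} | dx ≤ C Σ_{i ≠ j} e^{−σ|P_i − P_j|}. -/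
open MeasureTheory Filter Real Topology

noncomputable section

/-- Tangent-line bound: the increment of `t ↦ t ^ p` is at most the slope at the larger endpoint
times the length. -/
theorem rpow_sub_rpow_le_mul_sub {p a s : ℝ} (hp : 1 ≤ p) (ha : 0 ≤ a) (hs : 0 < s) :
    s ^ p - a ^ p ≤ p * s ^ (p - 1) * (s - a) := by
  have h := one_add_mul_self_le_rpow_one_add (s := a / s - 1)
    (by linarith [div_nonneg ha hs.le]) hp
  rw [add_sub_cancel, div_rpow ha hs.le, le_div_iff₀ (rpow_pos_of_pos hs p)] at h
  have hsp : s ^ p = s ^ (p - 1) * s := by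
    rw [← rpow_add_one hs.ne', sub_add_cancel]
  have key : (1 + p * (a / s - 1)) * s ^ p = s ^ p - p * s ^ (p - 1) * (s - a) := by
    rw [hsp]
    field_simp
    ring
  linarith

/-- The defect of additivity of `t ↦ t ^ (p + 1)` on a finite sum is controlled by the pairwise
products. -/
theorem abs_sum_rpow_sub_sum_rpow_le {ι : Type*} [Fintype ι] [DecidableEq ι] [Nonempty ι]
    {p M : ℝ} (hp : 1 ≤ p) (a : ι → ℝ) (ha : ∀ i, 0 < a i) (hM : ∑ i, a i ≤ M) :
    |(∑ i, a i) ^ (p + 1) - ∑ i, a i ^ (p + 1)| ≤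
      p * M ^ (p - 1) * ∑ i, ∑ j ∈ Finset.univ.filter (fun j => j ≠ i), a i * a j := by
  set s := ∑ i, a i with hs_def
  have hs : 0 < s := Finset.sum_pos (fun i _ => ha i) Finset.univ_nonempty
  have hle : ∀ i, a i ≤ s := fun i =>
    Finset.single_le_sum (fun j _ => (ha j).le) (Finset.mem_univ i)
  have hexpand : s ^ (p + 1) - ∑ i, a i ^ (p + 1) = ∑ i, a i * (s ^ p - a i ^ p) := by
    simp_rw [mul_sub, Finset.sum_sub_distrib, ← Finset.sum_mul]
    rw [rpow_add_one hs.ne', mul_comm (s ^ p), ← hs_def]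
    congr 1
    exact Finset.sum_congr rfl fun i _ => by rw [rpow_add_one (ha i).ne', mul_comm]
  have hrest : ∀ i, s - a i = ∑ j ∈ Finset.univ.filter (fun j => j ≠ i), a j := fun i => by
    rw [Finset.filter_ne', hs_def, ← Finset.add_sum_erase _ _ (Finset.mem_univ i)]
    ring
  rw [hexpand, abs_of_nonneg (Finset.sum_nonneg fun i _ => mul_nonneg (ha i).le
    (sub_nonneg.2 (rpow_le_rpow (ha i).le (hle i) (by linarith)))), Finset.mul_sum]
  refine Finset.sum_le_sum fun i _ => ?_
  rw [← Finset.mul_sum, ← hrest]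
  have h1 : s ^ p - a i ^ p ≤ p * M ^ (p - 1) * (s - a i) :=
    (rpow_sub_rpow_le_mul_sub hp (ha i).le hs).trans <| by
      have := hle i
      have h2 : s ^ (p - 1) ≤ M ^ (p - 1) := rpow_le_rpow hs.le hM (by linarith)
      exact mul_le_mul_of_nonneg_right (mul_le_mul_of_nonneg_left h2 (by linarith))
        (by linarith)
  calc a i * (s ^ p - a i ^ p) ≤ a i * (p * M ^ (p - 1) * (s - a i)) :=
        mul_le_mul_of_nonneg_left h1 (ha i).le
    _ = p * M ^ (p - 1) * (a i * (s - a i)) := by ring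

theorem integrable_exp_neg_mul_norm_s12 {E : Type*} [NormedAddCommGroup E] [NormedSpace ℝ E]
    [FiniteDimensional ℝ E] [Nontrivial E] [MeasurableSpace E] [BorelSpace E]
    (μ : Measure E) [μ.IsAddHaarMeasure] {b : ℝ} (hb : 0 < b) :
    Integrable (fun x : E => Real.exp (-b * ‖x‖)) μ := by
  rw [integrable_fun_norm_addHaar μ (f := fun r : ℝ => Real.exp (-b * r))]
  have h := integrableOn_rpow_mul_exp_neg_mul_rpow (p := 1)
    (s := ((Module.finrank ℝ E - 1 : ℕ) : ℝ)) (neg_one_lt_zero.trans_le (Nat.cast_nonneg _))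
    one_pos hb
  simpa only [rpow_one, rpow_natCast, smul_eq_mul] using h

/-- Two exponentially decaying profiles centred at `y` and `z` have a product that is
exponentially small in `‖y - z‖`. -/
theorem exp_neg_norm_mul_exp_neg_norm_le {E : Type*} [SeminormedAddCommGroup E] (x y z : E) :
    Real.exp (-‖x - y‖) * Real.exp (-‖x - z‖) ≤
      Real.exp (-(1 / 2) * ‖y - z‖) * Real.exp (-(1 / 2) * ‖x - y‖) := by
  rw [← Real.exp_add, ← Real.exp_add, Real.exp_le_exp]
  have h := norm_sub_le_norm_sub_add_norm_sub y x z
  rw [norm_sub_rev y x] at h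
  linarith [norm_nonneg (x - y), norm_nonneg (x - z)]

/-- interaction estimate for the `p+1` powers of a sum of `K` well-separated
bumps. -/
theorem sum_power_interaction_estimate (p : ℝ) (hp : 1 < p) (K : ℕ) (hK : 1 ≤ K)
    (U : E3 → ℝ) (hUc : Continuous U) (hUpos : ∀ x, 0 < U x)
    (CU : ℝ) (hCU : 0 < CU) (hUdecay : ∀ x, U x ≤ CU * Real.exp (-‖x‖)) :
    ∃ C > 0, ∃ σ > 0, ∀ P : Fin K → E3, (∀ i j, i ≠ j → 1 ≤ ‖P i - P j‖) →
      (∫ x : E3, |(∑ i, U (x - P i)) ^ (p + 1) - ∑ i, U (x - P i) ^ (p + 1)|) ≤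
        C * ∑ i, ∑ j ∈ Finset.univ.filter (fun j => j ≠ i),
          Real.exp (-σ * ‖P i - P j‖) := by
  classical
  have : Nonempty (Fin K) := ⟨⟨0, hK⟩⟩
  set I := ∫ x : E3, Real.exp (-(1 / 2) * ‖x‖) with hI
  have hint : Integrable (fun x : E3 => Real.exp (-(1 / 2) * ‖x‖)) :=
    integrable_exp_neg_mul_norm_s12 volume one_half_pos
  have hI0 : 0 ≤ I := integral_nonneg fun x => (Real.exp_pos _).le
  have hK0 : (0 : ℝ) < K := by exact_mod_cast hK
  set A := p * (K * CU) ^ (p - 1) with hA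
  have hA0 : 0 ≤ A := mul_nonneg (by linarith) (rpow_nonneg (by positivity) _)
  refine ⟨A * CU ^ 2 * I + 1, by positivity, 1 / 2, one_half_pos, fun P _ => ?_⟩
  have hUle : ∀ x, U x ≤ CU := fun x => (hUdecay x).trans <|
    mul_le_of_le_one_right hCU.le (Real.exp_le_one_iff.2 (neg_nonpos.2 (norm_nonneg x)))
  have hsum : ∀ x, ∑ i, U (x - P i) ≤ K * CU := fun x => by
    simpa using Finset.sum_le_card_nsmul Finset.univ _ CU fun i _ => hUle (x - P i)
  have hpair : ∀ x i j, U (x - P i) * U (x - P j) ≤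
      CU ^ 2 * (Real.exp (-(1 / 2) * ‖P i - P j‖) * Real.exp (-(1 / 2) * ‖x - P i‖)) := by
    intro x i j
    calc U (x - P i) * U (x - P j)
        ≤ (CU * Real.exp (-‖x - P i‖)) * (CU * Real.exp (-‖x - P j‖)) :=
          mul_le_mul (hUdecay _) (hUdecay _) (hUpos _).le (by positivity)
      _ = CU ^ 2 * (Real.exp (-‖x - P i‖) * Real.exp (-‖x - P j‖)) := by ring
      _ ≤ _ := mul_le_mul_of_nonneg_left (exp_neg_norm_mul_exp_neg_norm_le x _ _) (sq_nonneg _)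
  have hint' : ∀ i j, Integrable (fun x : E3 =>
      CU ^ 2 * (Real.exp (-(1 / 2) * ‖P i - P j‖) * Real.exp (-(1 / 2) * ‖x - P i‖))) :=
    fun i j => ((hint.comp_sub_right (P i)).const_mul _).const_mul _
  have hval : ∀ i j, ∫ x : E3,
      CU ^ 2 * (Real.exp (-(1 / 2) * ‖P i - P j‖) * Real.exp (-(1 / 2) * ‖x - P i‖)) =
      CU ^ 2 * I * Real.exp (-(1 / 2) * ‖P i - P j‖) := fun i j => by
    rw [integral_const_mul, integral_const_mul,
      integral_sub_right_eq_self (fun x : E3 => Real.exp (-(1 / 2) * ‖x‖)) (P i), ← hI]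
    ring
  set S := ∑ i, ∑ j ∈ Finset.univ.filter (fun j => j ≠ i),
    Real.exp (-(1 / 2) * ‖P i - P j‖) with hS
  have hS0 : 0 ≤ S :=
    Finset.sum_nonneg fun i _ => Finset.sum_nonneg fun j _ => (Real.exp_pos _).le
  calc (∫ x : E3, |(∑ i, U (x - P i)) ^ (p + 1) - ∑ i, U (x - P i) ^ (p + 1)|)
      ≤ ∫ x : E3, A * ∑ i, ∑ j ∈ Finset.univ.filter (fun j => j ≠ i),
          CU ^ 2 * (Real.exp (-(1 / 2) * ‖P i - P j‖) *
            Real.exp (-(1 / 2) * ‖x - P i‖)) := by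
        refine integral_mono_of_nonneg (.of_forall fun x => abs_nonneg _)
          ((integrable_finsetSum _ fun i _ => integrable_finsetSum _ fun j _ =>
            hint' i j).const_mul A) (.of_forall fun x => ?_)
        refine (abs_sum_rpow_sub_sum_rpow_le hp.le (fun i => U (x - P i))
          (fun i => hUpos _) (hsum x)).trans (mul_le_mul_of_nonneg_left ?_ hA0)
        exact Finset.sum_le_sum fun i _ => Finset.sum_le_sum fun j _ => hpair x i j
    _ = A * (CU ^ 2 * I * S) := by
        rw [integral_const_mul, integral_finsetSum _ (fun i _ =>
          integrable_finsetSum _ (fun j _ => hint' i j)), hS, Finset.mul_sum _ _ (CU ^ 2 * I)]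
        refine congrArg (A * ·) (Finset.sum_congr rfl fun i _ => ?_)
        rw [integral_finsetSum _ fun j _ => hint' i j, Finset.mul_sum]
        exact Finset.sum_congr rfl fun j _ => hval i j
    _ ≤ (A * CU ^ 2 * I + 1) * S := by linarith
end
end
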